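/- Let m ≥ 0 and k ≥ 0 be integers with m − k ≥ 2, and let γ > 1/2 be a real number. Then there exists a constant C > 0 (depending on γ, m, k) such that for every smooth function u : (0,1] × 𝕋 → ℂ with ‖u‖_{K_γ^m} < ∞, one has |∂_ψ^k u(ψ,θ)| ≤ C ψ^{γ − k − 1/2} ‖u‖_{K_γ^m} for all ψ ∈ (0,1] and θ ∈ 𝕋. -/

import Mathlib

open MeasureTheory Real Set ENNReal

noncomputable section

/-- The iterated partial derivative `∂_ψ^p ∂_θ^q u` of a function `u(ψ,θ)`. -/
def pder (p q : ℕ) (u : ℝ → ℝ → ℂ) : ℝ → ℝ → ℂ :=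
  fun ψ θ => iteratedDeriv p (fun s => iteratedDeriv q (u s) θ) ψ

/-- The square of the Kondratev norm `‖u‖_{K_γ^m}` on `Π = (0,1] × 𝕋`:
`‖u‖²_{K_γ^m} = Σ_{p+q≤m} ∫₀¹ ∫_𝕋 ψ^(2(p-γ)) |∂_ψ^p ∂_θ^q u(ψ,θ)|² dθ dψ`. -/
def KNormSq (γ : ℝ) (m : ℕ) (u : ℝ → ℝ → ℂ) : ℝ≥0∞ :=
  ∑ p ∈ Finset.range (m+1), ∑ q ∈ Finset.range (m+1-p),
    ∫⁻ ψ in Ioc (0:ℝ) 1, ∫⁻ θ in Ioc (0:ℝ) (2*π),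
      ENNReal.ofReal (ψ ^ (2*((p:ℝ) - γ)) * ‖pder p q u ψ θ‖^2)

/-- The Kondratev norm `‖u‖_{K_γ^m}`. -/
def KNorm (γ : ℝ) (m : ℕ) (u : ℝ → ℝ → ℂ) : ℝ≥0∞ := KNormSq γ m u ^ ((1:ℝ)/2)

/-- `u : (0,1] × 𝕋 → ℂ` is smooth: it is (jointly) smooth for `ψ > 0`
and `2π`-periodic in the angular variable `θ`. -/
def SmoothAnn (u : ℝ → ℝ → ℂ) : Prop :=
  ContDiffOn ℝ (⊤ : ℕ∞) (Function.uncurry u) (Ioi (0:ℝ) ×ˢ (univ : Set ℝ)) ∧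
    ∀ ψ θ, u ψ (θ + 2*π) = u ψ θ

/-- Joint smoothness on the open half-plane `ψ > 0`. -/
def SmoothHalf (u : ℝ → ℝ → ℂ) : Prop :=
  ContDiffOn ℝ (⊤ : ℕ∞) (Function.uncurry u) (Ioi (0:ℝ) ×ˢ (univ : Set ℝ))

lemma isOpen_half : IsOpen (Ioi (0:ℝ) ×ˢ (univ : Set ℝ)) := isOpen_Ioi.prod isOpen_univ

namespace SmoothHalf

variable {u : ℝ → ℝ → ℂ}

lemma congr {v : ℝ → ℝ → ℂ} (hu : SmoothHalf u) (h : ∀ s, 0 < s → ∀ θ, v s θ = u s θ) :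
    SmoothHalf v :=
  ContDiffOn.congr hu fun x hx => h x.1 hx.1 x.2

lemma contDiffAt (hu : SmoothHalf u) {s : ℝ} (hs : 0 < s) (θ : ℝ) :
    ContDiffAt ℝ (⊤ : ℕ∞) (Function.uncurry u) (s, θ) :=
  ContDiffOn.contDiffAt hu (isOpen_half.mem_nhds ⟨hs, mem_univ _⟩)

lemma hasFDerivAt (hu : SmoothHalf u) {s : ℝ} (hs : 0 < s) (θ : ℝ) :
    HasFDerivAt (Function.uncurry u) (fderiv ℝ (Function.uncurry u) (s, θ)) (s, θ) :=
  ((hu.contDiffAt hs θ).differentiableAt (by simp)).hasFDerivAt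

lemma hasDerivAt_left (hu : SmoothHalf u) {s : ℝ} (hs : 0 < s) (θ : ℝ) :
    HasDerivAt (fun t => u t θ) (fderiv ℝ (Function.uncurry u) (s, θ) (1, 0)) s :=
  (hu.hasFDerivAt hs θ).comp_hasDerivAt (f := fun t : ℝ => (t, θ)) s
    ((hasDerivAt_id s).prodMk (hasDerivAt_const s θ))

lemma hasDerivAt_right (hu : SmoothHalf u) {s : ℝ} (hs : 0 < s) (θ : ℝ) :
    HasDerivAt (u s) (fderiv ℝ (Function.uncurry u) (s, θ) (0, 1)) θ :=
  (hu.hasFDerivAt hs θ).comp_hasDerivAt (f := fun t : ℝ => (s, t)) θ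
    ((hasDerivAt_const θ s).prodMk (hasDerivAt_id θ))

lemma fderiv_apply (hu : SmoothHalf u) (w : ℝ × ℝ) :
    SmoothHalf fun s θ => fderiv ℝ (Function.uncurry u) (s, θ) w :=
  (hu.fderiv_of_isOpen (m := (⊤ : ℕ∞)) isOpen_half (by simp)).clm_apply contDiffOn_const

lemma deriv_left (hu : SmoothHalf u) : SmoothHalf fun s θ => deriv (fun t => u t θ) s :=
  (hu.fderiv_apply (1, 0)).congr fun _ hs θ => (hu.hasDerivAt_left hs θ).deriv

lemma deriv_right (hu : SmoothHalf u) : SmoothHalf fun s θ => deriv (u s) θ :=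
  (hu.fderiv_apply (0, 1)).congr fun _ hs θ => (hu.hasDerivAt_right hs θ).deriv

lemma fderiv_fderiv_apply (hu : SmoothHalf u) {s : ℝ} (hs : 0 < s) (θ : ℝ) (v w : ℝ × ℝ) :
    fderiv ℝ (Function.uncurry fun s θ => fderiv ℝ (Function.uncurry u) (s, θ) v) (s, θ) w =
      fderiv ℝ (fderiv ℝ (Function.uncurry u)) (s, θ) w v := by
  have h : DifferentiableAt ℝ (fderiv ℝ (Function.uncurry u)) (s, θ) :=
    ((hu.contDiffAt hs θ).fderiv_right (m := 1) (by norm_cast)).differentiableAt (by simp)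
  have := (h.hasFDerivAt.clm_apply (hasFDerivAt_const v (s, θ))).fderiv
  change fderiv ℝ (fun x => fderiv ℝ (Function.uncurry u) x v) (s, θ) w = _
  rw [this]
  simp

lemma deriv_comm (hu : SmoothHalf u) {s : ℝ} (hs : 0 < s) (θ : ℝ) :
    deriv (fun t => deriv (u t) θ) s = deriv (fun τ => deriv (fun t => u t τ) s) θ := by
  have h1 : (fun t => deriv (u t) θ) =ᶠ[nhds s]
      fun t => fderiv ℝ (Function.uncurry u) (t, θ) (0, 1) := by
    filter_upwards [Ioi_mem_nhds hs] with t ht using (hu.hasDerivAt_right ht θ).deriv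
  have h2 : (fun τ => deriv (fun t => u t τ) s) =
      fun τ => fderiv ℝ (Function.uncurry u) (s, τ) (1, 0) :=
    funext fun τ => (hu.hasDerivAt_left hs τ).deriv
  rw [h1.deriv_eq, h2, ((hu.fderiv_apply (0, 1)).hasDerivAt_left hs θ).deriv,
    ((hu.fderiv_apply (1, 0)).hasDerivAt_right hs θ).deriv, hu.fderiv_fderiv_apply hs,
    hu.fderiv_fderiv_apply hs]
  have h3 : (2 : WithTop ℕ∞) ≤ ((⊤ : ℕ∞) : WithTop ℕ∞) :=
    WithTop.coe_le_coe.2 (le_top : (2 : ℕ∞) ≤ ⊤)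
  exact ((hu.contDiffAt hs θ).isSymmSndFDerivAt (by simpa using h3)).eq _ _

lemma pder_zero (hu : SmoothHalf u) (p : ℕ) : SmoothHalf (pder p 0 u) := by
  induction p generalizing u with
  | zero => exact hu.congr fun s _ θ => by simp [pder]
  | succ p ih =>
    refine (ih hu.deriv_left).congr fun s _ θ => ?_
    simp only [pder, iteratedDeriv_zero]
    rw [iteratedDeriv_succ']

lemma pder_one (hu : SmoothHalf u) (p : ℕ) : SmoothHalf (pder p 1 u) := by
  refine (hu.deriv_right.pder_zero p).congr fun s _ θ => ?_
  simp [pder]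

lemma hasDerivAt_pder_right (hu : SmoothHalf u) (p : ℕ) {s : ℝ} (hs : 0 < s) (θ : ℝ) :
    HasDerivAt (pder p 0 u s) (pder p 1 u s θ) θ := by
  induction p generalizing u with
  | zero =>
    have h := hu.hasDerivAt_right hs θ
    have h0 : pder 0 0 u s = u s := by funext θ; simp [pder]
    have h1 : pder 0 1 u s θ = deriv (u s) θ := by simp [pder]
    rw [h0, h1, h.deriv]
    exact h
  | succ p ih =>
    have h0 : pder (p + 1) 0 u = pder p 0 fun s θ => deriv (fun t => u t θ) s := by
      funext s θ
      simp only [pder, iteratedDeriv_zero]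
      rw [iteratedDeriv_succ']
    have h1 : pder (p + 1) 1 u s θ = pder p 1 (fun s θ => deriv (fun t => u t θ) s) s θ := by
      simp only [pder, iteratedDeriv_one]
      rw [iteratedDeriv_succ']
      refine Filter.EventuallyEq.iteratedDeriv_eq p ?_
      filter_upwards [Ioi_mem_nhds hs] with t ht using hu.deriv_comm ht θ
    rw [h0, h1]
    exact ih hu.deriv_left

lemma hasDerivAt_pder_left (hu : SmoothHalf u) (p : ℕ) {s : ℝ} (hs : 0 < s) (θ : ℝ) :
    HasDerivAt (fun t => pder p 0 u t θ) (pder (p + 1) 0 u s θ) s := by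
  have h := (hu.pder_zero p).hasDerivAt_left hs θ
  have h' : pder (p + 1) 0 u s θ = deriv (fun t => pder p 0 u t θ) s := by
    simp only [pder]
    rw [iteratedDeriv_succ]
  rw [h', h.deriv]
  exact h

lemma continuousOn_left (hu : SmoothHalf u) (θ : ℝ) : ContinuousOn (fun t => u t θ) (Ioi 0) :=
  fun _ hs => (hu.hasDerivAt_left hs θ).continuousAt.continuousWithinAt

lemma continuous_right (hu : SmoothHalf u) {s : ℝ} (hs : 0 < s) : Continuous (u s) :=
  continuous_iff_continuousAt.2 fun θ => (hu.hasDerivAt_right hs θ).continuousAt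

lemma aemeasurable_lintegral (hu : SmoothHalf u) {a b : ℝ} (ha : 0 < a) (T : Set ℝ)
    (hT : MeasurableSet T) :
    AEMeasurable (fun s => ∫⁻ θ in T, ENNReal.ofReal (‖u s θ‖ ^ 2))
      (volume.restrict (Ioc a b)) := by
  have hm : AEMeasurable (fun x : ℝ × ℝ => ENNReal.ofReal (‖Function.uncurry u x‖ ^ 2))
      ((volume.restrict (Ioc a b)).prod (volume.restrict T)) := by
    rw [Measure.prod_restrict]
    have hc : ContinuousOn (Function.uncurry u) (Ioc a b ×ˢ T) :=
      (ContDiffOn.continuousOn hu).mono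
        (prod_mono (fun x hx => ha.trans hx.1) (subset_univ _))
    exact ((hc.norm.pow 2).aemeasurable (measurableSet_Ioc.prod hT)).ennreal_ofReal
  exact hm.lintegral_prod_right'

end SmoothHalf

/-- Cauchy–Schwarz against the constant function on an interval. -/
lemma sq_integral_le {g : ℝ → ℝ} {a b : ℝ} (hab : a < b) (hg : ContinuousOn g (Icc a b)) :
    (∫ t in a..b, g t) ^ 2 ≤ (b - a) * ∫ t in a..b, g t ^ 2 := by
  have hu : uIcc a b = Icc a b := uIcc_of_le hab.le
  have i1 : IntervalIntegrable g volume a b := (hu ▸ hg).intervalIntegrable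
  have i2 : IntervalIntegrable (fun t => g t ^ 2) volume a b :=
    (hu ▸ hg.pow 2).intervalIntegrable
  set I := ∫ t in a..b, g t with hI
  have h0 : 0 ≤ ∫ t in a..b, ((b - a) * g t - I) ^ 2 :=
    intervalIntegral.integral_nonneg hab.le fun t _ => sq_nonneg _
  have h1 : ∫ t in a..b, ((b - a) * g t - I) ^ 2 =
      (b - a) * ((b - a) * (∫ t in a..b, g t ^ 2) - I ^ 2) := by
    have : (fun t => ((b - a) * g t - I) ^ 2) =
        fun t => ((b - a) ^ 2 * g t ^ 2 - (2 * (b - a) * I) * g t) + I ^ 2 := by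
      funext t; ring
    rw [this, intervalIntegral.integral_add ((i2.const_mul _).sub (i1.const_mul _)) (by simp),
      intervalIntegral.integral_sub (i2.const_mul _) (i1.const_mul _),
      intervalIntegral.integral_const_mul, intervalIntegral.integral_const_mul,
      intervalIntegral.integral_const, ← hI, smul_eq_mul]
    ring
  rw [h1] at h0
  have := nonneg_of_mul_nonneg_right h0 (sub_pos.2 hab)
  linarith

lemma norm_sq_le_integral {f f' : ℝ → ℂ} {a b x : ℝ} (hab : a < b) (hx : x ∈ Icc a b)
    (hf : ∀ t ∈ Icc a b, HasDerivAt f (f' t) t) (hf' : ContinuousOn f' (Icc a b)) :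
    ‖f x‖ ^ 2 ≤ 2 / (b - a) * (∫ t in a..b, ‖f t‖ ^ 2) +
      2 * (b - a) * ∫ t in a..b, ‖f' t‖ ^ 2 := by
  have hu : uIcc a b = Icc a b := uIcc_of_le hab.le
  have hfc : ContinuousOn f (Icc a b) := fun t ht => (hf t ht).continuousAt.continuousWithinAt
  have i1 : IntervalIntegrable (fun t => ‖f t‖ ^ 2) volume a b :=
    (hu ▸ hfc.norm.pow 2).intervalIntegrable
  have i2 : IntervalIntegrable (fun t => ‖f' t‖) volume a b := (hu ▸ hf'.norm).intervalIntegrable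
  have i3 : IntervalIntegrable f' volume a b := (hu ▸ hf').intervalIntegrable
  have hcs := sq_integral_le hab hf'.norm
  set J := ∫ t in a..b, ‖f' t‖ ^ 2
  have hpt : ∀ t ∈ Icc a b, ‖f x‖ ^ 2 ≤ 2 * ‖f t‖ ^ 2 + 2 * ((b - a) * J) := by
    intro t ht
    have hsub : uIcc t x ⊆ Icc a b := hu ▸ uIcc_subset_uIcc (hu ▸ ht) (hu ▸ hx)
    have hftc : ∫ r in t..x, f' r = f x - f t :=
      intervalIntegral.integral_eq_sub_of_hasDerivAt (fun r hr => hf r (hsub hr))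
        (hf'.mono hsub).intervalIntegrable
    have hle : ‖f x - f t‖ ≤ ∫ r in a..b, ‖f' r‖ := by
      rw [← hftc, intervalIntegral.integral_of_le hab.le]
      refine intervalIntegral.norm_integral_le_integral_norm_uIoc.trans ?_
      refine setIntegral_mono_set ((intervalIntegrable_iff_integrableOn_Ioc_of_le hab.le).1 i2)
        (Filter.Eventually.of_forall fun _ => norm_nonneg _) (Filter.Eventually.of_forall ?_)
      exact Ioc_subset_Ioc (le_min ht.1 hx.1) (max_le ht.2 hx.2)
    have htri : ‖f x‖ ≤ ‖f t‖ + ‖f x - f t‖ := by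
      simpa using norm_add_le (f t) (f x - f t)
    have := norm_nonneg (f x)
    have := norm_nonneg (f t)
    have := norm_nonneg (f x - f t)
    set A := ∫ r in a..b, ‖f' r‖
    nlinarith [sq_nonneg (‖f t‖ - A)]
  have hint : ∫ _ in a..b, ‖f x‖ ^ 2 ≤ ∫ t in a..b, (2 * ‖f t‖ ^ 2 + 2 * ((b - a) * J)) :=
    intervalIntegral.integral_mono_on hab.le (by simp) ((i1.const_mul 2).add (by simp)) hpt
  rw [intervalIntegral.integral_add (i1.const_mul 2) (by simp),
    intervalIntegral.integral_const_mul, intervalIntegral.integral_const,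
    intervalIntegral.integral_const, smul_eq_mul, smul_eq_mul] at hint
  have hd : 0 < b - a := sub_pos.2 hab
  rw [← mul_le_mul_iff_of_pos_left hd]
  refine hint.trans (le_of_eq ?_)
  field_simp

/-- One-dimensional Sobolev inequality, with lower Lebesgue integrals. -/
lemma ofReal_norm_sq_le_lintegral {f f' : ℝ → ℂ} {a b x : ℝ} (hab : a < b) (hx : x ∈ Icc a b)
    (hf : ∀ t ∈ Icc a b, HasDerivAt f (f' t) t) (hf' : ContinuousOn f' (Icc a b)) :
    ENNReal.ofReal (‖f x‖ ^ 2) ≤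
      ENNReal.ofReal (2 / (b - a)) * (∫⁻ t in Ioc a b, ENNReal.ofReal (‖f t‖ ^ 2)) +
      ENNReal.ofReal (2 * (b - a)) * ∫⁻ t in Ioc a b, ENNReal.ofReal (‖f' t‖ ^ 2) := by
  have hd : 0 < b - a := sub_pos.2 hab
  have key : ∀ g : ℝ → ℂ, ContinuousOn g (Icc a b) →
      ∫⁻ t in Ioc a b, ENNReal.ofReal (‖g t‖ ^ 2) =
        ENNReal.ofReal (∫ t in a..b, ‖g t‖ ^ 2) := by
    intro g hg
    rw [intervalIntegral.integral_of_le hab.le]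
    refine (ofReal_integral_eq_lintegral_ofReal ?_
      (Filter.Eventually.of_forall fun _ => sq_nonneg _)).symm
    exact ((hg.norm.pow 2).integrableOn_Icc).mono_set Ioc_subset_Icc_self
  have nn : ∀ g : ℝ → ℂ, 0 ≤ ∫ t in a..b, ‖g t‖ ^ 2 := fun g =>
    intervalIntegral.integral_nonneg hab.le fun t _ => sq_nonneg _
  rw [key f fun t ht => (hf t ht).continuousAt.continuousWithinAt, key f' hf',
    ← ENNReal.ofReal_mul (by positivity), ← ENNReal.ofReal_mul (by positivity),
    ← ENNReal.ofReal_add (mul_nonneg (by positivity) (nn f)) (mul_nonneg (by positivity) (nn f'))]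
  exact ENNReal.ofReal_le_ofReal (norm_sq_le_integral hab hx hf hf')

lemma one_le_rpow_ratio {e s ψ : ℝ} (hψ : 0 < ψ) (h1 : ψ / 2 ≤ s) (h2 : s ≤ ψ) :
    1 ≤ 2 ^ |e| * ψ ^ (-e) * s ^ e := by
  have hs : 0 < s := lt_of_lt_of_le (by positivity) h1
  have hr : 0 < s / ψ := by positivity
  have hr1 : s / ψ ≤ 1 := (div_le_one hψ).2 h2
  have hr2 : 1 ≤ 2 * (s / ψ) := by
    rw [← mul_div_assoc, le_div_iff₀ hψ]; linarith
  calc (1:ℝ) ≤ (2 * (s / ψ)) ^ |e| := one_le_rpow hr2 (abs_nonneg e)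
    _ = 2 ^ |e| * (s / ψ) ^ |e| := mul_rpow (by norm_num) hr.le
    _ ≤ 2 ^ |e| * (s / ψ) ^ e := by
      gcongr ?_ * ?_
      exact rpow_le_rpow_of_exponent_ge hr hr1 (le_abs_self e)
    _ = 2 ^ |e| * ψ ^ (-e) * s ^ e := by
      rw [div_rpow hs.le hψ.le, rpow_neg hψ.le]; ring

lemma lintegral_le_KNormSq {γ : ℝ} {m p q : ℕ} (hpq : p + q ≤ m) (u : ℝ → ℝ → ℂ) :
    ∫⁻ ψ in Ioc (0:ℝ) 1, ∫⁻ θ in Ioc (0:ℝ) (2*π),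
      ENNReal.ofReal (ψ ^ (2*((p:ℝ) - γ)) * ‖pder p q u ψ θ‖^2) ≤ KNormSq γ m u := by
  unfold KNormSq
  refine le_trans ?_ (Finset.single_le_sum (fun _ _ => zero_le)
    (Finset.mem_range.2 (show p < m + 1 by omega)))
  exact Finset.single_le_sum (f := fun q => ∫⁻ ψ in Ioc (0:ℝ) 1, ∫⁻ θ in Ioc (0:ℝ) (2*π),
      ENNReal.ofReal (ψ ^ (2*((p:ℝ) - γ)) * ‖pder p q u ψ θ‖^2)) (fun _ _ => zero_le)
    (Finset.mem_range.2 (show q < m + 1 - p by omega))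

lemma lintegral_strip_le {γ : ℝ} {m p q : ℕ} (hpq : p + q ≤ m) (u : ℝ → ℝ → ℂ) {ψ : ℝ}
    (hψ : ψ ∈ Ioc (0:ℝ) 1) :
    ∫⁻ s in Ioc (ψ / 2) ψ, ∫⁻ θ in Ioc (0:ℝ) (2*π), ENNReal.ofReal (‖pder p q u s θ‖ ^ 2) ≤
      ENNReal.ofReal (2 ^ |2*((p:ℝ) - γ)| * ψ ^ (-(2*((p:ℝ) - γ)))) * KNormSq γ m u := by
  obtain ⟨h0, h1⟩ := hψ
  set e := 2*((p:ℝ) - γ)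
  have hK : 0 ≤ 2 ^ |e| * ψ ^ (-e) := by positivity
  calc _ ≤ ∫⁻ s in Ioc (ψ / 2) ψ, ENNReal.ofReal (2 ^ |e| * ψ ^ (-e)) *
        ∫⁻ θ in Ioc (0:ℝ) (2*π), ENNReal.ofReal (s ^ e * ‖pder p q u s θ‖ ^ 2) := by
        refine setLIntegral_mono' measurableSet_Ioc fun s hs => ?_
        rw [← lintegral_const_mul' _ _ ENNReal.ofReal_ne_top]
        refine lintegral_mono fun θ => ?_
        rw [← ENNReal.ofReal_mul hK, ← mul_assoc]
        exact ENNReal.ofReal_le_ofReal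
          (le_mul_of_one_le_left (sq_nonneg _) (one_le_rpow_ratio h0 hs.1.le hs.2))
    _ = ENNReal.ofReal (2 ^ |e| * ψ ^ (-e)) * ∫⁻ s in Ioc (ψ / 2) ψ,
        ∫⁻ θ in Ioc (0:ℝ) (2*π), ENNReal.ofReal (s ^ e * ‖pder p q u s θ‖ ^ 2) :=
      lintegral_const_mul' _ _ ENNReal.ofReal_ne_top
    _ ≤ _ := by
      gcongr
      exact (lintegral_mono_set (Ioc_subset_Ioc (by positivity) h1)).trans
        (lintegral_le_KNormSq hpq u)

lemma lintegral_segment_le {γ : ℝ} {m p : ℕ} (hp : p + 1 ≤ m) {u : ℝ → ℝ → ℂ}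
    (hu : SmoothHalf u) {ψ θ : ℝ} (hψ : ψ ∈ Ioc (0:ℝ) 1) (hθ : θ ∈ Icc 0 (2*π)) :
    ∫⁻ s in Ioc (ψ / 2) ψ, ENNReal.ofReal (‖pder p 0 u s θ‖ ^ 2) ≤
      ENNReal.ofReal ((1 / π + 4 * π) * (2 ^ |2*((p:ℝ) - γ)| * ψ ^ (-(2*((p:ℝ) - γ))))) *
        KNormSq γ m u := by
  have hpi := Real.pi_pos
  have h0 := hψ.1
  have e1 : 2 / (2 * π - 0) = 1 / π := by field_simp; simp
  have e2 : 2 * (2 * π - 0) = 4 * π := by ring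
  calc _ ≤ ∫⁻ s in Ioc (ψ / 2) ψ,
        (ENNReal.ofReal (1 / π) *
          (∫⁻ t in Ioc (0:ℝ) (2*π), ENNReal.ofReal (‖pder p 0 u s t‖ ^ 2)) +
        ENNReal.ofReal (4 * π) *
          ∫⁻ t in Ioc (0:ℝ) (2*π), ENNReal.ofReal (‖pder p 1 u s t‖ ^ 2)) := by
        refine setLIntegral_mono' measurableSet_Ioc fun s hs => ?_
        have hs0 : 0 < s := lt_trans (by positivity) hs.1
        have := ofReal_norm_sq_le_lintegral (by positivity) hθ
          (fun t _ => hu.hasDerivAt_pder_right p hs0 t)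
          ((hu.pder_one p).continuous_right hs0).continuousOn
        rwa [e1, e2] at this
    _ = ENNReal.ofReal (1 / π) * (∫⁻ s in Ioc (ψ / 2) ψ,
          ∫⁻ t in Ioc (0:ℝ) (2*π), ENNReal.ofReal (‖pder p 0 u s t‖ ^ 2)) +
        ENNReal.ofReal (4 * π) * ∫⁻ s in Ioc (ψ / 2) ψ,
          ∫⁻ t in Ioc (0:ℝ) (2*π), ENNReal.ofReal (‖pder p 1 u s t‖ ^ 2) := by
        rw [lintegral_add_left' (((hu.pder_zero p).aemeasurable_lintegral (by positivity) _
          measurableSet_Ioc).const_mul _), lintegral_const_mul' _ _ ENNReal.ofReal_ne_top,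
          lintegral_const_mul' _ _ ENNReal.ofReal_ne_top]
    _ ≤ ENNReal.ofReal (1 / π) * (ENNReal.ofReal
            (2 ^ |2*((p:ℝ) - γ)| * ψ ^ (-(2*((p:ℝ) - γ)))) * KNormSq γ m u) +
        ENNReal.ofReal (4 * π) * (ENNReal.ofReal
            (2 ^ |2*((p:ℝ) - γ)| * ψ ^ (-(2*((p:ℝ) - γ)))) * KNormSq γ m u) := by
        gcongr
        · exact lintegral_strip_le (by omega) u hψ
        · exact lintegral_strip_le hp u hψ
    _ = _ := by
        rw [← add_mul, ← ENNReal.ofReal_add (by positivity) (by positivity), ← mul_assoc,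
          ← ENNReal.ofReal_mul (by positivity)]

lemma ofReal_norm_pder_sq_le {γ : ℝ} {m k : ℕ} (hmk : k + 2 ≤ m) {u : ℝ → ℝ → ℂ}
    (hu : SmoothHalf u) {ψ θ : ℝ} (hψ : ψ ∈ Ioc (0:ℝ) 1) (hθ : θ ∈ Icc 0 (2*π)) :
    ENNReal.ofReal (‖pder k 0 u ψ θ‖ ^ 2) ≤
      ENNReal.ofReal ((1 / π + 4 * π) * (4 * 2 ^ |2*((k:ℝ) - γ)| + 2 ^ |2*((k:ℝ) + 1 - γ)|) *
        (ψ ^ (γ - (k:ℝ) - 1/2)) ^ 2) * KNormSq γ m u := by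
  have hpi := Real.pi_pos
  have h0 := hψ.1
  have e1 : 2 / (ψ - ψ / 2) = 4 / ψ := by field_simp; norm_num
  have e2 : 2 * (ψ - ψ / 2) = ψ := by ring
  have h := ofReal_norm_sq_le_lintegral (f := fun t => pder k 0 u t θ)
    (f' := fun t => pder (k + 1) 0 u t θ) (half_lt_self h0) (right_mem_Icc.2 (by linarith))
    (fun t ht => hu.hasDerivAt_pder_left k (lt_of_lt_of_le (by positivity) ht.1) θ)
    (((hu.pder_zero (k + 1)).continuousOn_left θ).mono
      fun t ht => lt_of_lt_of_le (by positivity) ht.1)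
  rw [e1, e2] at h
  have hA := lintegral_segment_le (γ := γ) (show k + 1 ≤ m by omega) hu hψ hθ
  have hB := lintegral_segment_le (γ := γ) (show k + 1 + 1 ≤ m by omega) hu hψ hθ
  refine (h.trans (add_le_add (mul_le_mul_right hA _) (mul_le_mul_right hB _))).trans
    (le_of_eq ?_)
  rw [← mul_assoc (ENNReal.ofReal (4 / ψ)), ← mul_assoc (ENNReal.ofReal ψ), ← add_mul,
    ← ENNReal.ofReal_mul (by positivity), ← ENNReal.ofReal_mul (by positivity), ← ENNReal.ofReal_add (by positivity) (by positivity)]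
  congr 2
  have hsq : (ψ ^ (γ - (k:ℝ) - 1/2)) ^ 2 = ψ ^ (2 * (γ - (k:ℝ)) - 1) := by
    rw [← Real.rpow_natCast, ← Real.rpow_mul h0.le]
    congr 1; push_cast; ring
  have p0 : ψ ^ (-(2*((k:ℝ) - γ))) = ψ * (ψ ^ (γ - (k:ℝ) - 1/2)) ^ 2 := by
    rw [hsq, rpow_sub_one h0.ne', mul_div_cancel₀ _ h0.ne']
    congr 1; ring
  have p1 : ψ * ψ ^ (-(2*((k:ℝ) + 1 - γ))) = (ψ ^ (γ - (k:ℝ) - 1/2)) ^ 2 := by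
    rw [hsq, mul_comm, ← rpow_add_one h0.ne']
    congr 1; ring
  push_cast
  rw [p0]
  calc _ = (1 / π + 4 * π) * (4 * 2 ^ |2*((k:ℝ) - γ)| * (ψ ^ (γ - (k:ℝ) - 1/2)) ^ 2 +
        2 ^ |2*((k:ℝ) + 1 - γ)| * (ψ * ψ ^ (-(2*((k:ℝ) + 1 - γ))))) := by
        field_simp
    _ = _ := by rw [p1]; ring

lemma pder_zero_periodic {u : ℝ → ℝ → ℂ} (hu : ∀ ψ θ, u ψ (θ + 2*π) = u ψ θ) (k : ℕ) (ψ : ℝ) :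
    Function.Periodic (pder k 0 u ψ) (2*π) := by
  intro θ
  simp [pder, hu]

/-- **Pointwise Morrey-type estimate for Kondratev spaces**: for `m - k ≥ 2` and
`γ > 1/2`, `|∂_ψ^k u(ψ,θ)| ≤ C ψ^(γ-k-1/2) ‖u‖_{K_γ^m}` on `(0,1] × 𝕋`. -/
theorem kondratev_pointwise_estimate (m k : ℕ) (hmk : k + 2 ≤ m) (γ : ℝ) (hγ : 1/2 < γ) :
    ∃ C > 0, ∀ u : ℝ → ℝ → ℂ, SmoothAnn u → KNorm γ m u ≠ ⊤ →
      ∀ ψ ∈ Ioc (0:ℝ) 1, ∀ θ : ℝ,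
        ‖pder k 0 u ψ θ‖ ≤ C * ψ ^ (γ - (k:ℝ) - 1/2) * (KNorm γ m u).toReal := by
  have hpi := Real.pi_pos
  set A := (1 / π + 4 * π) * (4 * 2 ^ |2*((k:ℝ) - γ)| + 2 ^ |2*((k:ℝ) + 1 - γ)|)
  have hA : 0 < A := by positivity
  refine ⟨√A, Real.sqrt_pos.2 hA, fun u hu hfin ψ hψ θ => ?_⟩
  have hN : KNormSq γ m u ≠ ⊤ := by
    intro h
    exact hfin (by rw [KNorm, h, ENNReal.top_rpow_of_pos (by norm_num)])
  obtain ⟨t, ht, hEq⟩ := (pder_zero_periodic hu.2 k ψ).exists_mem_Ico₀ (by positivity) θ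
  rw [hEq]
  have h := ofReal_norm_pder_sq_le (γ := γ) hmk hu.1 hψ (Ico_subset_Icc_self ht)
  rw [← ENNReal.ofReal_toReal hN, ← ENNReal.ofReal_mul (by positivity),
    ENNReal.ofReal_le_ofReal_iff (by positivity)] at h
  have hS : (KNorm γ m u).toReal ^ 2 = (KNormSq γ m u).toReal := by
    rw [KNorm, ← ENNReal.toReal_rpow, ← Real.sqrt_eq_rpow, Real.sq_sqrt ENNReal.toReal_nonneg]
  have hψ0 := hψ.1
  refine le_of_sq_le_sq ?_ (by positivity)
  rw [mul_pow, mul_pow, Real.sq_sqrt hA.le, hS]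
  exact h
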